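/- arXiv:0706.1973 — 3 statements merged into one kernel-verified Lean document; each statement's English description precedes it below -/
import Mathlib

section
/- The quadruple (A1, A2, A3, A4) is a 4-(247; 123, 111, 123, 114; 224) supplementary difference set in Z_247; that is, |A1| = 123, |A2| = 111, |A3| = 123, |A4| = 114, and for every nonzero d ∈ Z_247, the total number of ordered pairs (x, y) with x, y ∈ A_i and x − y = d, summed over i = 1, 2, 3, 4, equals 224. -/
open Finset Matrix

/-- The subgroup H of order 9 of the multiplicative group of `ZMod 247`. -/
def H : Finset (ZMod 247) := {1, 9, 16, 55, 61, 81, 139, 144, 235}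

/-- Representatives of the even-indexed orbits. -/
def rep : List (ZMod 247) := [1, 2, 3, 5, 6, 7, 10, 11, 13, 14, 17, 19, 33, 35, 38]

/-- The orbits `α i`: `α (2*i) = rep[i] • H` and `α (2*i+1) = -α (2*i)`. -/
def alpha (i : ℕ) : Finset (ZMod 247) :=
  if i % 2 = 0 then H.image (fun h => rep.getD (i / 2) 0 * h)
  else (H.image (fun h => rep.getD (i / 2) 0 * h)).image (fun x => -x)

def A1 : Finset (ZMod 247) := ({0, 2, 4, 7, 8, 10, 12, 15, 16, 18, 20, 23, 25, 27, 29} : Finset ℕ).biUnion alpha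
def A2 : Finset (ZMod 247) := ({0, 2, 7, 9, 11, 12, 14, 15, 16, 18, 20, 22, 26} : Finset ℕ).biUnion alpha
def A3 : Finset (ZMod 247) := ({2, 3, 4, 12, 13, 14, 15, 16, 18, 20, 23, 24, 26, 27, 29} : Finset ℕ).biUnion alpha
def A4 : Finset (ZMod 247) := ({0, 3, 4, 6, 10, 11, 12, 14, 18, 19, 20, 22, 25, 29} : Finset ℕ).biUnion alpha

/-- The number of ones among the `k` lowest binary digits of `n`. -/
def lowBitCount (k n : ℕ) : ℕ :=
  Nat.rec (fun _ => 0) (fun _ f n => n % 2 + f (n / 2)) k n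

theorem lowBitCount_eq_sum (k n : ℕ) :
    lowBitCount k n = ∑ i ∈ range k, if n.testBit i then 1 else 0 := by
  induction k generalizing n with
  | zero => rfl
  | succ k ih =>
    have h : lowBitCount (k + 1) n = n % 2 + lowBitCount k (n / 2) := rfl
    rw [h, ih, sum_range_succ', add_comm]
    congr 1
    · simp only [Nat.testBit_succ]
    · rcases Nat.mod_two_eq_zero_or_one n with h | h <;> simp [Nat.testBit_zero, h]

/-- The subset of `ZMod 247` with bitmask `m`. -/
def bitSet (m : ℕ) : Finset (ZMod 247) := univ.filter fun x => m.testBit x.val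

theorem sum_univ_zmod_eq_sum_range (f : ℕ → ℕ) :
    ∑ x : ZMod 247, f x.val = ∑ i ∈ range 247, f i :=
  (Finset.sum_range f).symm

theorem card_bitSet (m : ℕ) : (bitSet m).card = lowBitCount 247 m := by
  rw [bitSet, card_filter, lowBitCount_eq_sum]
  exact sum_univ_zmod_eq_sum_range fun i => if m.testBit i then 1 else 0

/-- The number of cyclic coincidences between `m` and its shift by `d`. -/
def autocorrelation (m d : ℕ) : ℕ :=
  lowBitCount 247 (m &&& (m >>> d ||| m <<< (247 - d)))

theorem testBit_rotate {m d i : ℕ} (hm : m < 2 ^ 247) (hd : d < 247) (hi : i < 247) :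
    (m >>> d ||| m <<< (247 - d)).testBit i = m.testBit ((i + d) % 247) := by
  rw [Nat.testBit_or, Nat.testBit_shiftRight, Nat.testBit_shiftLeft]
  by_cases h : i + d < 247
  · rw [Nat.mod_eq_of_lt h, add_comm d i]
    simp [show ¬ i ≥ 247 - d by omega]
  · have h₁ : (i + d) % 247 = i - (247 - d) := by omega
    have h₂ : m.testBit (d + i) = false :=
      Nat.testBit_lt_two_pow (hm.trans_le (Nat.pow_le_pow_right two_pos (by omega)))
    simp [h₁, h₂, show i ≥ 247 - d by omega]

theorem card_sub_eq_autocorrelation {m : ℕ} (hm : m < 2 ^ 247) (d : ZMod 247) :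
    ((bitSet m ×ˢ bitSet m).filter (fun p => p.1 - p.2 = d)).card =
      autocorrelation m d.val := by
  have h : ((bitSet m ×ˢ bitSet m).filter (fun p => p.1 - p.2 = d)).card =
      (univ.filter fun y : ZMod 247 => y ∈ bitSet m ∧ y + d ∈ bitSet m).card := by
    refine card_bij' (fun p _ => p.2) (fun y _ => (y + d, y)) ?_ ?_ ?_ ?_
    · rintro ⟨x, y⟩ hxy
      simp only [mem_filter, mem_product, mem_univ, true_and] at hxy ⊢
      obtain ⟨⟨hx, hy⟩, rfl⟩ := hxy
      simpa using ⟨hy, hx⟩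
    · intro y hy
      simp only [mem_filter, mem_product, mem_univ, true_and] at hy ⊢
      exact ⟨⟨hy.2, hy.1⟩, by ring⟩
    · rintro ⟨x, y⟩ hxy
      simp only [mem_filter] at hxy
      simp [← hxy.2]
    · intro y _
      rfl
  rw [h, card_filter, autocorrelation, lowBitCount_eq_sum, ← sum_univ_zmod_eq_sum_range]
  refine sum_congr rfl fun y _ => ?_
  rw [Nat.testBit_and, testBit_rotate hm d.val_lt y.val_lt, ← ZMod.val_add]
  simp [bitSet]

/-- The bitmask of `A1`. -/
def mask1 : ℕ := 22258662162780282922560454145407936493989615081711336651291885159209985742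

/-- The bitmask of `A2`. -/
def mask2 : ℕ := 12533885828745557902425191066058067865704952333242760558813191085625437958

/-- The bitmask of `A3`. -/
def mask3 : ℕ := 71006558602897047309105703325217512995929854051840387762603597291437059084

/-- The bitmask of `A4`. -/
def mask4 : ℕ := 72517916818678767284971150142130398860327911880985938147469357358698450602

theorem A1_eq_bitSet : A1 = bitSet mask1 := by decide +kernel

theorem A2_eq_bitSet : A2 = bitSet mask2 := by decide +kernel

theorem A3_eq_bitSet : A3 = bitSet mask3 := by decide +kernel

theorem A4_eq_bitSet : A4 = bitSet mask4 := by decide +kernel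

theorem sum_autocorrelation_masks : ∀ d < 247, d ≠ 0 →
    autocorrelation mask1 d + autocorrelation mask2 d + autocorrelation mask3 d +
      autocorrelation mask4 d = 224 := by
  decide +kernel

theorem sds_A :
    A1.card = 123 ∧ A2.card = 111 ∧ A3.card = 123 ∧ A4.card = 114 ∧
    ∀ d : ZMod 247, d ≠ 0 →
      ((A1 ×ˢ A1).filter (fun p => p.1 - p.2 = d)).card +
      ((A2 ×ˢ A2).filter (fun p => p.1 - p.2 = d)).card +
      ((A3 ×ˢ A3).filter (fun p => p.1 - p.2 = d)).card +
      ((A4 ×ˢ A4).filter (fun p => p.1 - p.2 = d)).card = 224 := by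
  rw [A1_eq_bitSet, A2_eq_bitSet, A3_eq_bitSet, A4_eq_bitSet]
  simp only [card_bitSet]
  refine ⟨by decide +kernel, by decide +kernel, by decide +kernel, by decide +kernel,
    fun d hd => ?_⟩
  rw [card_sub_eq_autocorrelation (by decide +kernel),
    card_sub_eq_autocorrelation (by decide +kernel),
    card_sub_eq_autocorrelation (by decide +kernel),
    card_sub_eq_autocorrelation (by decide +kernel)]
  exact sum_autocorrelation_masks d.val d.val_lt ((ZMod.val_ne_zero d).mpr hd)
end

section
/- The quadruple (B1, B2, B3, B4) is a 4-(247; 123, 111, 123, 114; 224) supplementary difference set in Z_247; that is, |B1| = 123, |B2| = 111, |B3| = 123, |B4| = 114, and for every nonzero d ∈ Z_247, the total number of ordered pairs (x, y) with x, y ∈ B_i and x − y = d, summed over i = 1, 2, 3, 4, equals 224. -/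
open Finset Matrix

def B1 : Finset (ZMod 247) := ({0, 3, 5, 7, 8, 11, 12, 15, 17, 18, 21, 22, 24, 27, 29} : Finset ℕ).biUnion alpha
def B2 : Finset (ZMod 247) := ({3, 5, 6, 8, 11, 13, 14, 15, 16, 19, 26, 27, 29} : Finset ℕ).biUnion alpha
def B3 : Finset (ZMod 247) := ({0, 1, 2, 4, 5, 7, 11, 13, 14, 15, 22, 23, 24, 26, 27} : Finset ℕ).biUnion alpha
def B4 : Finset (ZMod 247) := ({0, 3, 8, 9, 10, 11, 13, 17, 19, 24, 25, 27, 28, 29} : Finset ℕ).biUnion alpha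

/-- The subset of `ZMod 247` whose members are the positions of the nonzero binary digits of `m`. -/
def ofBits (m : ℕ) : Finset (ZMod 247) := univ.filter fun x => m.testBit x.val

/-- The number of `y < 247` such that the binary digits of `m` at `y` and at `(y + d) % 247` are
both nonzero. -/
def bitCorr (m d : ℕ) : ℕ :=
  (List.range 247).countP fun y => m.testBit y && m.testBit ((y + d) % 247)

theorem card_filter_sub_eq_bitCorr (m : ℕ) (d : ZMod 247) :
    ((ofBits m ×ˢ ofBits m).filter (fun p => p.1 - p.2 = d)).card = bitCorr m d.val := by
  have hcount : bitCorr m d.val =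
      ((range 247).filter fun y => m.testBit y && m.testBit ((y + d.val) % 247)).card := by
    simp [bitCorr, List.countP_eq_length_filter, Finset.card, Finset.filter, Finset.range,
      Multiset.range]
  rw [hcount]
  refine card_bij (fun p _ => p.2.val) ?_ ?_ ?_
  · rintro ⟨x, y⟩ h
    simp only [ofBits, mem_filter, mem_product, mem_univ, true_and, mem_range,
      Bool.and_eq_true, ← ZMod.val_add] at h ⊢
    obtain ⟨⟨hx, hy⟩, rfl⟩ := h
    exact ⟨y.val_lt, hy, by rwa [add_sub_cancel]⟩
  · rintro ⟨x, y⟩ h ⟨x', y'⟩ h' hyy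
    obtain rfl : y = y' := ZMod.val_injective 247 hyy
    have hx : x - y = d := (mem_filter.1 h).2
    have hx' : x' - y = d := (mem_filter.1 h').2
    rw [sub_left_injective (hx.trans hx'.symm)]
  · intro y h
    simp only [mem_filter, mem_range, Bool.and_eq_true] at h
    obtain ⟨hlt, hy, hyd⟩ := h
    have hval : (y : ZMod 247).val = y := ZMod.val_cast_of_lt hlt
    refine ⟨((y : ZMod 247) + d, (y : ZMod 247)), ?_, hval⟩
    simp [ofBits, ZMod.val_add, hval, hy, hyd]

theorem card_filter_sub_pow_mul {R : Type*} [CommRing R] [DecidableEq R] {B : Finset R} {u : R}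
    (hu : IsUnit u) (hB : ∀ x, u * x ∈ B ↔ x ∈ B) (k : ℕ) (d : R) :
    ((B ×ˢ B).filter (fun p => p.1 - p.2 = u ^ k * d)).card =
      ((B ×ˢ B).filter (fun p => p.1 - p.2 = d)).card := by
  induction k with
  | zero => simp
  | succ k ih =>
    rw [← ih, pow_succ', mul_assoc]
    symm
    refine card_bij (fun p _ => (u * p.1, u * p.2)) ?_ ?_ ?_
    · rintro ⟨x, y⟩ h
      simpa [hB, ← mul_sub, hu.mul_right_inj] using h
    · rintro ⟨x, y⟩ - ⟨x', y'⟩ - h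
      simpa [hu.mul_right_inj] using h
    · rintro ⟨x, y⟩ h
      obtain ⟨x, rfl⟩ := hu.dvd (a := x)
      obtain ⟨y, rfl⟩ := hu.dvd (a := y)
      exact ⟨(x, y), by simpa [hB, ← mul_sub, hu.mul_right_inj] using h, rfl⟩

/-- The characteristic bit vector of `B1`. -/
def bits1 : ℕ :=
  94722407301435329911947095724297822495440806385864603168648713505912505938

/-- The characteristic bit vector of `B2`. -/
def bits2 : ℕ :=
  87805208903860918232083646574043587096042594895012468134299878140940429424

/-- The characteristic bit vector of `B3`. -/
def bits3 : ℕ :=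
  165149100515261184222846157001986855387988174531584039579033607513612065310

/-- The characteristic bit vector of `B4`. -/
def bits4 : ℕ :=
  63048531903880129656324535199438684402091374957986015243755897688947786690

theorem B1_eq_ofBits : B1 = ofBits bits1 := by
  decide +kernel

theorem B2_eq_ofBits : B2 = ofBits bits2 := by
  decide +kernel

theorem B3_eq_ofBits : B3 = ofBits bits3 := by
  decide +kernel

theorem B4_eq_ofBits : B4 = ofBits bits4 := by
  decide +kernel

theorem nine_mul_mem_B1 (x : ZMod 247) : 9 * x ∈ B1 ↔ x ∈ B1 := by
  rw [B1_eq_ofBits]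
  simp only [ofBits, mem_filter, mem_univ, true_and]
  revert x
  decide +kernel

theorem nine_mul_mem_B2 (x : ZMod 247) : 9 * x ∈ B2 ↔ x ∈ B2 := by
  rw [B2_eq_ofBits]
  simp only [ofBits, mem_filter, mem_univ, true_and]
  revert x
  decide +kernel

theorem nine_mul_mem_B3 (x : ZMod 247) : 9 * x ∈ B3 ↔ x ∈ B3 := by
  rw [B3_eq_ofBits]
  simp only [ofBits, mem_filter, mem_univ, true_and]
  revert x
  decide +kernel

theorem nine_mul_mem_B4 (x : ZMod 247) : 9 * x ∈ B4 ↔ x ∈ B4 := by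
  rw [B4_eq_ofBits]
  simp only [ofBits, mem_filter, mem_univ, true_and]
  revert x
  decide +kernel

/-- The least positive residues of the orbits of multiplication by `9` on the nonzero elements of
`ZMod 247`. -/
def orbitReps : List ℕ :=
  [1, 2, 3, 4, 5, 6, 7, 8, 10, 11, 12, 13, 14, 15, 17, 19, 21, 22, 23, 24, 26, 33, 35, 38, 42, 44,
    51, 70, 76, 133]

theorem sum_bitCorr_eq (d : ℕ) (hd : d ∈ orbitReps) :
    bitCorr bits1 d + bitCorr bits2 d + bitCorr bits3 d + bitCorr bits4 d = 224 := by
  revert d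
  decide +kernel

theorem exists_nine_pow_mul_val_mem (d : ZMod 247) (hd : d ≠ 0) :
    ∃ k < 9, (9 ^ k * d).val ∈ orbitReps := by
  revert d
  decide +kernel

theorem sds_B :
    B1.card = 123 ∧ B2.card = 111 ∧ B3.card = 123 ∧ B4.card = 114 ∧
    ∀ d : ZMod 247, d ≠ 0 →
      ((B1 ×ˢ B1).filter (fun p => p.1 - p.2 = d)).card +
      ((B2 ×ˢ B2).filter (fun p => p.1 - p.2 = d)).card +
      ((B3 ×ˢ B3).filter (fun p => p.1 - p.2 = d)).card +
      ((B4 ×ˢ B4).filter (fun p => p.1 - p.2 = d)).card = 224 := by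
  have card_eq_ofBits : B1.card = 123 ∧ B2.card = 111 ∧ B3.card = 123 ∧ B4.card = 114 := by
    rw [B1_eq_ofBits, B2_eq_ofBits, B3_eq_ofBits, B4_eq_ofBits]
    decide +kernel
  obtain ⟨h1, h2, h3, h4⟩ := card_eq_ofBits
  refine ⟨h1, h2, h3, h4, fun d hd => ?_⟩
  obtain ⟨k, -, hk⟩ := exists_nine_pow_mul_val_mem d hd
  have hu : IsUnit (9 : ZMod 247) := IsUnit.of_mul_eq_one 55 (by decide)
  rw [← card_filter_sub_pow_mul hu nine_mul_mem_B1 k d,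
    ← card_filter_sub_pow_mul hu nine_mul_mem_B2 k d,
    ← card_filter_sub_pow_mul hu nine_mul_mem_B3 k d,
    ← card_filter_sub_pow_mul hu nine_mul_mem_B4 k d,
    B1_eq_ofBits, B2_eq_ofBits, B3_eq_ofBits, B4_eq_ofBits]
  simp only [card_filter_sub_eq_bitCorr]
  exact sum_bitCorr_eq _ hk
end

section
/- The sets A2 and B2 in Z_247 are not equivalent under translations and multiplications by invertible elements; that is, there do not exist a unit a ∈ Z_247 and an element b ∈ Z_247 such that {a · x + b : x ∈ A2} = B2. -/
open Finset Matrix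

theorem mem_alpha {i : ℕ} {x : ZMod 247} :
    x ∈ alpha i ↔ ∃ k ∈ H, (if i % 2 = 0 then 1 else -1) * rep.getD (i / 2) 0 * k = x := by
  unfold alpha
  split_ifs <;> simp only [mem_image, exists_exists_and_eq_and, one_mul, neg_mul]

theorem mul_mem_alpha {h : ZMod 247} (hh : h ∈ H) {i : ℕ} {x : ZMod 247} (hx : x ∈ alpha i) :
    h * x ∈ alpha i := by
  have hmul : ∀ h ∈ H, ∀ k ∈ H, h * k ∈ H := by decide +kernel
  obtain ⟨k, hk, rfl⟩ := mem_alpha.mp hx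
  exact mem_alpha.mpr ⟨h * k, hmul h hh k hk, mul_left_comm _ h k⟩

theorem mul_mem_biUnion_alpha {h : ZMod 247} (hh : h ∈ H) {J : Finset ℕ} {x : ZMod 247}
    (hx : x ∈ J.biUnion alpha) : h * x ∈ J.biUnion alpha := by
  obtain ⟨i, hi, hxi⟩ := mem_biUnion.mp hx
  exact mem_biUnion.mpr ⟨i, hi, mul_mem_alpha hh hxi⟩

theorem mul_mem_B2 {x : ZMod 247} (hx : x ∈ B2) : 9 * x ∈ B2 :=
  mul_mem_biUnion_alpha (by decide) hx

theorem exists_mul_eq_of_mem_A2 {x : ZMod 247} (hx : x ∈ A2) : ∃ y ∈ A2, 9 * y = x := by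
  refine ⟨55 * x, mul_mem_biUnion_alpha (by decide) hx, ?_⟩
  rw [← mul_assoc, show (9 * 55 : ZMod 247) = 1 by decide, one_mul]

/-- The natural number whose binary digits form the indicator function of `B2`. -/
def maskB2 : ℕ := 87805208903860918232083646574043587096042594895012468134299878140940429424

theorem testBit_of_mem_B2 {x : ZMod 247} (hx : x ∈ B2) : maskB2.testBit x.val := by
  have h : ∀ i ∈ ({3, 5, 6, 8, 11, 13, 14, 15, 16, 19, 26, 27, 29} : Finset ℕ), ∀ k ∈ H,
      maskB2.testBit ((if i % 2 = 0 then 1 else -1) * rep.getD (i / 2) 0 * k).val := by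
    decide +kernel
  obtain ⟨i, hi, hxi⟩ := mem_biUnion.mp hx
  obtain ⟨k, hk, rfl⟩ := mem_alpha.mp hxi
  exact h i hi k hk

/-- `B2` is not invariant under any nonzero translation. -/
theorem eq_zero_of_forall_add_mem_B2 {b : ZMod 247} (h : ∀ x ∈ B2, x + b ∈ B2) : b = 0 := by
  have hmem : ∀ m ∈ ([4, 15, 66, 99, 23] : List ℕ), (m : ZMod 247) ∈ B2 := by
    simp only [B2, mem_biUnion, mem_alpha]
    decide +kernel
  have key : ∀ n < 247, (∀ m ∈ [4, 15, 66, 99, 23], maskB2.testBit ((m + n) % 247)) → n = 0 := by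
    decide +kernel
  refine (ZMod.val_eq_zero b).mp (key b.val b.val_lt fun m hm => ?_)
  rw [← Nat.mod_add_mod, ← ZMod.val_natCast 247 m, ← ZMod.val_add]
  exact testBit_of_mem_B2 (h m (hmem m hm))

/-- No dilation maps `A2` into `B2`. -/
theorem exists_mul_notMem_B2 (a : ZMod 247) : ∃ x ∈ A2, a * x ∉ B2 := by
  have hmem : ∀ m ∈ ([19, 1, 2] : List ℕ), (m : ZMod 247) ∈ A2 := by
    simp only [A2, mem_biUnion, mem_alpha]
    decide +kernel
  have key : ∀ n < 247, ∃ m ∈ [19, 1, 2], ¬ maskB2.testBit (n * m % 247) := by decide +kernel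
  obtain ⟨m, hm, hnot⟩ := key a.val a.val_lt
  rw [← Nat.mul_mod_mod, ← ZMod.val_natCast 247 m, ← ZMod.val_mul] at hnot
  exact ⟨m, hmem m hm, fun h => hnot (testBit_of_mem_B2 h)⟩

theorem not_equivalent :
    ¬ ∃ (a : (ZMod 247)ˣ) (b : ZMod 247),
        A2.image (fun x => (a : ZMod 247) * x + b) = B2 := by
  rintro ⟨a, b, hab⟩
  have maps : ∀ x ∈ A2, (a : ZMod 247) * x + b ∈ B2 := fun x hx =>
    hab ▸ mem_image_of_mem _ hx
  have hb : 8 * b = 0 := by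
    refine eq_zero_of_forall_add_mem_B2 fun z hz => ?_
    obtain ⟨x, hx, rfl⟩ := mem_image.mp (hab.symm ▸ hz)
    obtain ⟨y, hy, rfl⟩ := exists_mul_eq_of_mem_A2 hx
    convert mul_mem_B2 (maps y hy) using 1
    ring
  have hb0 : b = 0 := by
    calc b = 31 * (8 * b) := by
          rw [← mul_assoc, show (31 * 8 : ZMod 247) = 1 by decide, one_mul]
      _ = 0 := by rw [hb, mul_zero]
  obtain ⟨x, hx, hnot⟩ := exists_mul_notMem_B2 a
  exact hnot (by simpa [hb0] using maps x hx)
end
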